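/- Fix S > 0 and x₀ ∈ ℝⁿ. Suppose the solution y(·) of the dual ODE ẏ(t) = T(y(t)) − y(t) with y(0) = ∇g(x₀) exists on [0,S] and stays in a compact subset of ℝⁿ. For each η > 0 let (y_k^η) be the explicit Euler sequence y_{k+1}^η = y_k^η + η(T(y_k^η) − y_k^η) with y₀^η = ∇g(x₀), and let y^η : [0,S] → ℝⁿ be its piecewise affine interpolation, y^η(t) = y_k^η + ((t − kη)/η)(y_{k+1}^η − y_k^η) for t ∈ [kη,(k+1)η]; set x^η(t) := (∇g)⁻¹(y^η(t)). Then, as η ↓ 0, y^η converges uniformly on [0,S] to y, and x^η converges uniformly on [0,S] to the unique solution x of the primal system ∇²g(x(t)) ẋ(t) = ∇h(x(t)) − ∇g(x(t)) = −∇f(x(t)) with x(0) = x₀. -/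

import Mathlib

open Set Filter Topology Function

/-- The explicit Euler sequence `y_{k+1} = y_k + η (T y_k − y_k)` started at `y0`. -/
noncomputable def eulerSeq {n : ℕ} (T : EuclideanSpace ℝ (Fin n) → EuclideanSpace ℝ (Fin n))
    (y0 : EuclideanSpace ℝ (Fin n)) (η : ℝ) : ℕ → EuclideanSpace ℝ (Fin n)
  | 0 => y0
  | k + 1 => eulerSeq T y0 η k + η • (T (eulerSeq T y0 η k) - eulerSeq T y0 η k)

/-- The piecewise affine interpolation of the Euler sequence with timestep `η`:
for `t ∈ [kη, (k+1)η]` (where `k = ⌊t/η⌋`),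
`y^η(t) = y_k + ((t − kη)/η)(y_{k+1} − y_k)`. -/
noncomputable def eulerInterp {n : ℕ} (T : EuclideanSpace ℝ (Fin n) → EuclideanSpace ℝ (Fin n))
    (y0 : EuclideanSpace ℝ (Fin n)) (η : ℝ) (t : ℝ) : EuclideanSpace ℝ (Fin n) :=
  eulerSeq T y0 η ⌊t / η⌋₊ +
    ((t - (⌊t / η⌋₊ : ℝ) * η) / η) •
      (eulerSeq T y0 η (⌊t / η⌋₊ + 1) - eulerSeq T y0 η ⌊t / η⌋₊)

open scoped NNReal RealInnerProductSpace

section Gradient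

variable {E : Type*} [NormedAddCommGroup E] [InnerProductSpace ℝ E] [CompleteSpace E]

/-- The gradient of a `C²` function is `C¹`. -/
theorem ContDiff.gradient_of_two {g : E → ℝ} (hg : ContDiff ℝ 2 g) :
    ContDiff ℝ 1 (gradient g) :=
  (InnerProductSpace.toDual ℝ E).symm.contDiff.comp (hg.fderiv_right (by norm_num))

/-- The gradient of a strongly convex function is strongly monotone. -/
theorem ConvexOn.mul_sq_le_inner_gradient_sub {g : E → ℝ} {μ : ℝ} (hg : Differentiable ℝ g)
    (hsc : ConvexOn ℝ univ (fun x => g x - μ / 2 * ‖x‖ ^ 2)) (a b : E) :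
    μ * ‖b - a‖ ^ 2 ≤ ⟪gradient g b - gradient g a, b - a⟫ := by
  have hline : ∀ t : ℝ, HasDerivAt (AffineMap.lineMap a b : ℝ → E) (b - a) t :=
    fun t => AffineMap.hasDerivAt_lineMap
  have hd : ∀ t : ℝ, HasDerivAt
      ((fun x => g x - μ / 2 * ‖x‖ ^ 2) ∘ ⇑(AffineMap.lineMap a b : ℝ →ᵃ[ℝ] E))
      (⟪gradient g (AffineMap.lineMap a b t), b - a⟫
        - μ / 2 * (2 * ⟪AffineMap.lineMap a b t, b - a⟫)) t := by
    intro t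
    have h1 := (hg (AffineMap.lineMap a b t)).hasFDerivAt.comp_hasDerivAt t (hline t)
    rw [← inner_gradient_left] at h1
    exact h1.sub ((hline t).norm_sq.const_mul (μ / 2))
  have hc : ConvexOn ℝ univ
      ((fun x => g x - μ / 2 * ‖x‖ ^ 2) ∘ ⇑(AffineMap.lineMap a b : ℝ →ᵃ[ℝ] E)) :=
    hsc.comp_affineMap (AffineMap.lineMap a b : ℝ →ᵃ[ℝ] E)
  have h := (hc.le_slope_of_hasDerivAt (mem_univ 0) (mem_univ 1) one_pos (hd 0)).trans
    (hc.slope_le_of_hasDerivAt (mem_univ 0) (mem_univ 1) one_pos (hd 1))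
  simp only [AffineMap.lineMap_apply_zero, AffineMap.lineMap_apply_one] at h
  have h2 : ‖b - a‖ ^ 2 = ⟪b, b - a⟫ - ⟪a, b - a⟫ := by
    rw [← inner_sub_left, real_inner_self_eq_norm_sq]
  rw [inner_sub_left, h2]
  linarith

/-- The gradient of a strongly convex function is expanding. -/
theorem ConvexOn.mul_norm_le_norm_gradient_sub {g : E → ℝ} {μ : ℝ} (hg : Differentiable ℝ g)
    (hsc : ConvexOn ℝ univ (fun x => g x - μ / 2 * ‖x‖ ^ 2)) (a b : E) :
    μ * ‖b - a‖ ≤ ‖gradient g b - gradient g a‖ := by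
  rcases (norm_nonneg (b - a)).eq_or_lt with h0 | h0
  · simp [← h0]
  · have h := (hsc.mul_sq_le_inner_gradient_sub hg a b).trans (real_inner_le_norm _ _)
    nlinarith

end Gradient

section Expanding

/-- An expanding map is antilipschitz. -/
theorem antilipschitzWith_of_expanding {E : Type*} [SeminormedAddCommGroup E] {G : E → E} {μ : ℝ≥0} (hμ : 0 < μ)
    (hexp : ∀ a b, μ * ‖b - a‖ ≤ ‖G b - G a‖) : AntilipschitzWith μ⁻¹ G := by
  refine AntilipschitzWith.of_le_mul_dist fun a b => ?_
  have hμ' : (0 : ℝ) < μ := hμ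
  rw [dist_eq_norm, dist_eq_norm, NNReal.coe_inv, inv_mul_eq_div, le_div_iff₀ hμ']
  linarith [hexp b a]

variable {E : Type*} [NormedAddCommGroup E] [NormedSpace ℝ E]

/-- The derivative of an expanding map is expanding. -/
theorem HasFDerivAt.mul_norm_le_of_expanding {G : E → E} {G' : E →L[ℝ] E} {x : E} {μ : ℝ}
    (hG : HasFDerivAt G G' x) (hexp : ∀ a b, μ * ‖b - a‖ ≤ ‖G b - G a‖) (v : E) :
    μ * ‖v‖ ≤ ‖G' v‖ := by
  have hd : HasDerivAt (fun t : ℝ => G (x + t • v)) (G' v) 0 := by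
    have hl : HasDerivAt (fun t : ℝ => x + t • v) v 0 := by
      simpa using ((hasDerivAt_id (0 : ℝ)).smul_const v).const_add x
    exact HasFDerivAt.comp_hasDerivAt (0 : ℝ) (by simpa using hG) hl
  refine ge_of_tendsto (hasDerivAt_iff_tendsto_slope_zero.1 hd).norm ?_
  filter_upwards [self_mem_nhdsWithin] with t ht
  have ht' : 0 < ‖t‖ := norm_pos_iff.2 ht
  have h := hexp x (x + t • v)
  rw [add_sub_cancel_left, norm_smul] at h
  rw [norm_smul, norm_inv, zero_add, zero_smul, add_zero, inv_mul_eq_div, le_div_iff₀ ht']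
  linarith

/-- An expanding linear endomorphism of a finite-dimensional space is a linear equivalence. -/
theorem ContinuousLinearMap.exists_equiv_of_expanding [FiniteDimensional ℝ E] {μ : ℝ} (hμ : 0 < μ)
    (A : E →L[ℝ] E) (hA : ∀ v, μ * ‖v‖ ≤ ‖A v‖) : ∃ e : E ≃L[ℝ] E, (e : E →L[ℝ] E) = A := by
  have hinj : Injective (A : E →ₗ[ℝ] E) := by
    rw [injective_iff_map_eq_zero]
    intro v hv
    have h := hA v
    rw [show A v = 0 from hv, norm_zero] at h
    exact norm_le_zero_iff.1 (nonpos_of_mul_nonpos_right h hμ)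
  refine ⟨(LinearEquiv.ofInjectiveEndo _ hinj).toContinuousLinearEquiv, ?_⟩
  ext v
  rfl

/-- A `C¹` expanding map of a finite-dimensional space is surjective. -/
theorem ContDiff.surjective_of_expanding [FiniteDimensional ℝ E] {G : E → E} {μ : ℝ≥0}
    (hμ : 0 < μ) (hG : ContDiff ℝ 1 G) (hexp : ∀ a b, μ * ‖b - a‖ ≤ ‖G b - G a‖) :
    Surjective G := by
  have : CompleteSpace E := FiniteDimensional.complete ℝ E
  have he : ∀ x, ∃ e : E ≃L[ℝ] E, (e : E →L[ℝ] E) = fderiv ℝ G x := fun x =>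
    (fderiv ℝ G x).exists_equiv_of_expanding hμ
      ((hG.differentiable one_ne_zero x).hasFDerivAt.mul_norm_le_of_expanding hexp)
  choose e he using he
  have hopen : IsOpenMap G := isOpenMap_of_hasStrictFDerivAt_equiv (f' := e) fun x => by
    rw [he]
    exact hG.contDiffAt.hasStrictFDerivAt one_ne_zero
  have hclosed : IsClosed (range G) :=
    (isProperMap_iff_tendsto_cocompact.2 ⟨hG.continuous, by
      simpa only [Metric.cobounded_eq_cocompact] using
        (antilipschitzWith_of_expanding hμ hexp).tendsto_cobounded⟩).isClosedMap.isClosed_range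
  exact range_eq_univ.1 (IsClopen.eq_univ ⟨hclosed, hopen.isOpen_range⟩ (range_nonempty G))

end Expanding

section Euler

variable {E : Type*} [NormedAddCommGroup E] [NormedSpace ℝ E]

/-- A locally Lipschitz vector field has at most one integral curve on `[0, S]` with given initial
value. -/
theorem LocallyLipschitz.eqOn_of_hasDerivAt [ProperSpace E] {F : E → E} (hF : LocallyLipschitz F)
    {S : ℝ} {u v : ℝ → E} (hu : ∀ t ∈ Icc 0 S, HasDerivAt u (F (u t)) t)
    (hv : ∀ t ∈ Icc 0 S, HasDerivAt v (F (v t)) t) (h0 : u 0 = v 0) : EqOn u v (Icc 0 S) := by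
  have huc : ContinuousOn u (Icc 0 S) := fun t ht => (hu t ht).continuousAt.continuousWithinAt
  have hvc : ContinuousOn v (Icc 0 S) := fun t ht => (hv t ht).continuousAt.continuousWithinAt
  obtain ⟨L, hL⟩ := hF.locallyLipschitzOn.exists_lipschitzOnWith_of_compact
    ((isCompact_Icc.image_of_continuousOn huc).union (isCompact_Icc.image_of_continuousOn hvc))
  exact ODE_solution_unique_of_mem_Icc_right (v := fun _ => F) (fun t _ => hL)
    huc (fun t ht => (hu t (Ico_subset_Icc_self ht)).hasDerivWithinAt)
    (fun t ht => Or.inl (mem_image_of_mem u (Ico_subset_Icc_self ht)))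
    hvc (fun t ht => (hv t (Ico_subset_Icc_self ht)).hasDerivWithinAt)
    (fun t ht => Or.inr (mem_image_of_mem v (Ico_subset_Icc_self ht))) h0

/-- Local error of the explicit Euler method along a solution staying where the vector field is
`L`-Lipschitz and bounded by `M`. -/
theorem norm_euler_local_error_le {F : E → E} {s : Set E} {L : ℝ≥0} {M a b : ℝ} {y : ℝ → E}
    (hab : a ≤ b) (hF : LipschitzOnWith L F s) (hM : ∀ t ∈ Icc a b, ‖F (y t)‖ ≤ M)
    (hys : ∀ t ∈ Icc a b, y t ∈ s) (hy : ∀ t ∈ Icc a b, HasDerivAt y (F (y t)) t) :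
    ‖y b - y a - (b - a) • F (y a)‖ ≤ L * M * (b - a) * (b - a) := by
  have hM0 : 0 ≤ M := (norm_nonneg _).trans (hM a (left_mem_Icc.2 hab))
  have hlip : ∀ t ∈ Icc a b, ‖y t - y a‖ ≤ M * (b - a) := fun t ht => by
    refine ((convex_Icc a b).norm_image_sub_le_of_norm_hasDerivWithin_le
      (fun r hr => (hy r hr).hasDerivWithinAt) hM (left_mem_Icc.2 hab) ht).trans ?_
    rw [Real.norm_of_nonneg (sub_nonneg.2 ht.1)]
    exact mul_le_mul_of_nonneg_left (by linarith [ht.2]) hM0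
  have hd : ∀ t ∈ Icc a b, HasDerivWithinAt (fun r => y r - r • F (y a))
      (F (y t) - (1 : ℝ) • F (y a)) (Icc a b) t := fun t ht =>
    ((hy t ht).sub ((hasDerivAt_id t).smul_const (F (y a)))).hasDerivWithinAt
  have h := (convex_Icc a b).norm_image_sub_le_of_norm_hasDerivWithin_le (C := L * M * (b - a)) hd
    (fun t ht => by
      rw [one_smul, mul_assoc]
      exact (hF.norm_sub_le (hys t ht) (hys a (left_mem_Icc.2 hab))).trans
        (mul_le_mul_of_nonneg_left (hlip t ht) L.2))
    (left_mem_Icc.2 hab) (right_mem_Icc.2 hab)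
  rw [Real.norm_of_nonneg (sub_nonneg.2 hab)] at h
  convert h using 2
  rw [sub_smul]
  abel

/-- One explicit Euler step started near a solution. -/
theorem norm_euler_step_sub_le {F : E → E} {s : Set E} {L : ℝ≥0} {M a b η : ℝ} {y : ℝ → E} {u : E}
    (hab : a ≤ b) (hη : b - a ≤ η) (hF : LipschitzOnWith L F s)
    (hM : ∀ t ∈ Icc a b, ‖F (y t)‖ ≤ M)
    (hys : ∀ t ∈ Icc a b, y t ∈ s) (hy : ∀ t ∈ Icc a b, HasDerivAt y (F (y t)) t) (hu : u ∈ s) :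
    ‖u + (b - a) • F u - y b‖ ≤ (1 + η * L) * ‖u - y a‖ + L * M * η * η := by
  have hM0 : 0 ≤ M := (norm_nonneg _).trans (hM a (left_mem_Icc.2 hab))
  have hba : 0 ≤ b - a := sub_nonneg.2 hab
  have h1 := norm_euler_local_error_le hab hF hM hys hy
  have h2 := hF.norm_sub_le hu (hys a (left_mem_Icc.2 hab))
  have h3 : ‖(b - a) • (F u - F (y a))‖ ≤ η * (L * ‖u - y a‖) := by
    rw [norm_smul, Real.norm_of_nonneg hba]
    exact mul_le_mul hη h2 (norm_nonneg _) (hba.trans hη)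
  have h4 : L * M * (b - a) * (b - a) ≤ L * M * η * η := by
    have hLM : 0 ≤ L * M := mul_nonneg L.2 hM0
    have hη0 : 0 ≤ η := hba.trans hη
    have hLMη : 0 ≤ L * M * η := mul_nonneg hLM hη0
    gcongr
  calc ‖u + (b - a) • F u - y b‖
      = ‖(u - y a) + (b - a) • (F u - F (y a)) - (y b - y a - (b - a) • F (y a))‖ := by
        congr 1
        rw [smul_sub]
        abel
    _ ≤ ‖u - y a‖ + ‖(b - a) • (F u - F (y a))‖ + ‖y b - y a - (b - a) • F (y a)‖ :=
        (norm_sub_le _ _).trans (by gcongr; exact norm_add_le _ _)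
    _ ≤ _ := by linarith

end Euler

section EulerConvergence

variable {n : ℕ} {T : EuclideanSpace ℝ (Fin n) → EuclideanSpace ℝ (Fin n)}
  {y : ℝ → EuclideanSpace ℝ (Fin n)} {y0 : EuclideanSpace ℝ (Fin n)} {L : ℝ≥0} {M S : ℝ}

/-- Global error of the explicit Euler sequence, for steps small enough to stay in the tube of
radius `1` around the solution on which the vector field is Lipschitz. -/
theorem norm_eulerSeq_sub_le {η : ℝ} (hη : 0 < η) (hM : 0 ≤ M) (hy0 : y 0 = y0)
    (hF : LipschitzOnWith L (fun v => T v - v) (Metric.cthickening 1 (y '' Icc 0 S)))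
    (hFM : ∀ t ∈ Icc 0 S, ‖T (y t) - y t‖ ≤ M)
    (hy : ∀ t ∈ Icc 0 S, HasDerivAt y (T (y t) - y t) t)
    (hsmall : Real.exp (L * S) * S * (L * M) * η ≤ 1) (k : ℕ) (hk : k * η ≤ S) :
    ‖eulerSeq T y0 η k - y (k * η)‖ ≤ Real.exp (L * (k * η)) * (k * η) * (L * M) * η := by
  induction k with
  | zero => simp [eulerSeq, hy0]
  | succ k ih =>
    push_cast at hk ⊢
    have hkη : (0 : ℝ) ≤ k * η := by positivity
    have hkS : k * η ≤ S := by linarith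
    have ih := ih hkS
    have hsub : Icc (k * η) ((k + 1) * η) ⊆ Icc 0 S := Icc_subset_Icc hkη hk
    have hLM : 0 ≤ L * M := mul_nonneg L.2 hM
    have hmem : eulerSeq T y0 η k ∈ Metric.cthickening 1 (y '' Icc 0 S) := by
      refine Metric.mem_cthickening_of_dist_le _ (y (k * η)) _ _
        (mem_image_of_mem y ⟨hkη, hkS⟩) ?_
      rw [dist_eq_norm]
      refine ih.trans (le_trans ?_ hsmall)
      gcongr
    have h := norm_euler_step_sub_le (η := η) (by linarith) (by linarith) hF
      (fun t ht => hFM t (hsub ht))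
      (fun t ht => Metric.self_subset_cthickening _ (mem_image_of_mem y (hsub ht)))
      (fun t ht => hy t (hsub ht)) hmem
    rw [show (k + 1) * η - k * η = η by ring] at h
    have hexp : (1 + η * L) * Real.exp (L * (k * η)) ≤ Real.exp (L * ((k + 1) * η)) := by
      rw [show L * ((k + 1) * η) = η * L + L * (k * η) by ring, Real.exp_add]
      gcongr
      linarith [Real.add_one_le_exp (η * L)]
    have hone : 1 ≤ Real.exp (L * ((k + 1) * η)) := Real.one_le_exp (by positivity)
    calc ‖eulerSeq T y0 η (k + 1) - y ((k + 1) * η)‖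
        ≤ (1 + η * L) * ‖eulerSeq T y0 η k - y (k * η)‖ + L * M * η * η := h
      _ ≤ (1 + η * L) * (Real.exp (L * (k * η)) * (k * η) * (L * M) * η) + 1 * (L * M * η * η) := by
          rw [one_mul]
          gcongr
      _ = ((1 + η * L) * Real.exp (L * (k * η))) * ((k * η) * (L * M) * η)
            + 1 * (L * M * η * η) := by ring
      _ ≤ Real.exp (L * ((k + 1) * η)) * ((k * η) * (L * M) * η)
            + Real.exp (L * ((k + 1) * η)) * (L * M * η * η) := by gcongr
      _ = _ := by ring

/-- Global error of the Euler interpolant. -/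
theorem norm_eulerInterp_sub_le {η : ℝ} (hη : 0 < η) (hM : 0 ≤ M) (hy0 : y 0 = y0)
    (hF : LipschitzOnWith L (fun v => T v - v) (Metric.cthickening 1 (y '' Icc 0 S)))
    (hFM : ∀ t ∈ Icc 0 S, ‖T (y t) - y t‖ ≤ M)
    (hy : ∀ t ∈ Icc 0 S, HasDerivAt y (T (y t) - y t) t)
    (hsmall : Real.exp (L * S) * S * (L * M) * η ≤ 1) {t : ℝ} (ht : t ∈ Icc 0 S) :
    ‖eulerInterp T y0 η t - y t‖ ≤
      (1 + η * L) * (Real.exp (L * S) * S * (L * M) * η) + L * M * η * η := by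
  set k := ⌊t / η⌋₊ with hkdef
  have hkt : k * η ≤ t := (le_div_iff₀ hη).1 (Nat.floor_le (div_nonneg ht.1 hη.le))
  have htk : t < (k + 1) * η := (div_lt_iff₀ hη).1 (Nat.lt_floor_add_one _)
  have hkη : (0 : ℝ) ≤ k * η := by positivity
  have hkS : k * η ≤ S := hkt.trans ht.2
  have hsub : Icc (k * η) t ⊆ Icc 0 S := Icc_subset_Icc hkη ht.2
  have hLM : 0 ≤ L * M := mul_nonneg L.2 hM
  have hk : ‖eulerSeq T y0 η k - y (k * η)‖ ≤ Real.exp (L * S) * S * (L * M) * η := by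
    refine (norm_eulerSeq_sub_le hη hM hy0 hF hFM hy hsmall k hkS).trans ?_
    gcongr
  have hmem : eulerSeq T y0 η k ∈ Metric.cthickening 1 (y '' Icc 0 S) :=
    Metric.mem_cthickening_of_dist_le _ (y (k * η)) _ _ (mem_image_of_mem y ⟨hkη, hkS⟩)
      (by rw [dist_eq_norm]; exact hk.trans hsmall)
  have h := norm_euler_step_sub_le (η := η) hkt (by linarith) hF
    (fun t ht => hFM t (hsub ht))
    (fun t ht => Metric.self_subset_cthickening _ (mem_image_of_mem y (hsub ht)))
    (fun t ht => hy t (hsub ht)) hmem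
  have hstep : eulerInterp T y0 η t = eulerSeq T y0 η k
      + (t - k * η) • (T (eulerSeq T y0 η k) - eulerSeq T y0 η k) := by
    simp only [eulerInterp, ← hkdef, eulerSeq, add_sub_cancel_left, smul_smul]
    rw [div_mul_cancel₀ _ hη.ne']
  rw [hstep]
  refine h.trans ?_
  gcongr

/-- The Euler interpolants of a locally Lipschitz vector field converge uniformly to the solution
on its interval of existence. -/
theorem tendstoUniformlyOn_eulerInterp (hT : LocallyLipschitz (fun v => T v - v)) (hy0 : y 0 = y0)
    (hy : ∀ t ∈ Icc 0 S, HasDerivAt y (T (y t) - y t) t) :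
    TendstoUniformlyOn (fun η t => eulerInterp T y0 η t) y (𝓝[>] 0) (Icc 0 S) := by
  have hyc : ContinuousOn y (Icc 0 S) := fun t ht => (hy t ht).continuousAt.continuousWithinAt
  have hcomp : IsCompact (y '' Icc 0 S) := isCompact_Icc.image_of_continuousOn hyc
  obtain ⟨L, hL⟩ := hT.locallyLipschitzOn.exists_lipschitzOnWith_of_compact
    (hcomp.cthickening (r := 1))
  obtain ⟨M, hM⟩ := isCompact_Icc.exists_bound_of_continuousOn
    (hT.continuous.comp_continuousOn hyc)
  have hM' : ∀ t ∈ Icc 0 S, ‖T (y t) - y t‖ ≤ max M 0 := fun t ht =>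
    (hM t ht).trans (le_max_left _ _)
  have htend : ∀ φ : ℝ → ℝ, Continuous φ → φ 0 = 0 → Tendsto φ (𝓝[>] 0) (𝓝 0) := fun φ hφ h0 =>
    (h0 ▸ hφ.tendsto 0).mono_left nhdsWithin_le_nhds
  have hsmall := htend (fun η => Real.exp (L * S) * S * (L * max M 0) * η) (by fun_prop) (by simp)
  have herr := htend (fun η => (1 + η * L) * (Real.exp (L * S) * S * (L * max M 0) * η)
    + L * max M 0 * η * η) (by fun_prop) (by simp)
  rw [Metric.tendstoUniformlyOn_iff]
  intro ε hε
  filter_upwards [self_mem_nhdsWithin, hsmall.eventually_le_const one_pos,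
    herr.eventually_lt_const hε] with η hη h1 h2 t ht
  rw [dist_comm, dist_eq_norm]
  exact (norm_eulerInterp_sub_le hη (le_max_right _ _) hy0 hL hM' hy h1 ht).trans_lt h2

end EulerConvergence

/-- If the solution `y` of the dual ODE `ẏ = T(y) − y`, `y(0) = ∇g(x₀)`,
stays in a compact set on `[0,S]`, then as `η ↓ 0` the piecewise affine Euler interpolants
converge uniformly on `[0,S]` to `y`, and the primal interpolants `(∇g)⁻¹ ∘ y^η` converge
uniformly to the unique solution `x` of `∇²g(x) ẋ = ∇h(x) − ∇g(x) = −∇f(x)`, `x(0) = x₀`. -/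
theorem stmt_2 (n : ℕ) (hn : 1 ≤ n) (μ : ℝ) (hμ : 0 < μ)
    (g h f : EuclideanSpace ℝ (Fin n) → ℝ)
    (hg : ContDiff ℝ 2 g) (hh : ContDiff ℝ 2 h)
    (hf : f = fun z => g z - h z)
    (hsc : ConvexOn ℝ Set.univ (fun x => g x - μ / 2 * ‖x‖ ^ 2))
    (T : EuclideanSpace ℝ (Fin n) → EuclideanSpace ℝ (Fin n))
    (hT : ∀ y, T y = gradient h (Function.invFun (gradient g) y))
    (S : ℝ) (hS : 0 < S) (x₀ : EuclideanSpace ℝ (Fin n))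
    (y : ℝ → EuclideanSpace ℝ (Fin n))
    (hy0 : y 0 = gradient g x₀)
    (hy : ∀ t ∈ Set.Icc (0:ℝ) S, HasDerivAt y (T (y t) - y t) t)
    (K : Set (EuclideanSpace ℝ (Fin n))) (hK : IsCompact K)
    (hyK : ∀ t ∈ Set.Icc (0:ℝ) S, y t ∈ K) :
    TendstoUniformlyOn (fun η t => eulerInterp T (gradient g x₀) η t) y
      (𝓝[>] 0) (Set.Icc 0 S) ∧
    ∃ x x' : ℝ → EuclideanSpace ℝ (Fin n),
      x 0 = x₀ ∧
      (∀ t ∈ Set.Icc (0:ℝ) S, HasDerivAt x (x' t) t ∧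
        fderiv ℝ (gradient g) (x t) (x' t) = gradient h (x t) - gradient g (x t) ∧
        fderiv ℝ (gradient g) (x t) (x' t) = -gradient f (x t)) ∧
      (∀ z z' : ℝ → EuclideanSpace ℝ (Fin n), z 0 = x₀ →
        (∀ t ∈ Set.Icc (0:ℝ) S, HasDerivAt z (z' t) t ∧
          fderiv ℝ (gradient g) (z t) (z' t) = gradient h (z t) - gradient g (z t)) →
        Set.EqOn z x (Set.Icc 0 S)) ∧
      TendstoUniformlyOn
        (fun η t => Function.invFun (gradient g) (eulerInterp T (gradient g x₀) η t))
        x (𝓝[>] 0) (Set.Icc 0 S) := by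
  have hgd : Differentiable ℝ g := hg.differentiable two_ne_zero
  have hhd : Differentiable ℝ h := hh.differentiable two_ne_zero
  have hG1 : ContDiff ℝ 1 (gradient g) := hg.gradient_of_two
  have hGd : Differentiable ℝ (gradient g) := hG1.differentiable one_ne_zero
  lift μ to ℝ≥0 using hμ.le
  have hμ' : 0 < μ := hμ
  have hexp := hsc.mul_norm_le_norm_gradient_sub hgd
  have hanti : AntilipschitzWith μ⁻¹ (gradient g) := antilipschitzWith_of_expanding hμ' hexp
  have hsurj : Surjective (gradient g) := hG1.surjective_of_expanding hμ' hexp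
  have hleft : LeftInverse (invFun (gradient g)) (gradient g) := leftInverse_invFun hanti.injective
  have hright : RightInverse (invFun (gradient g)) (gradient g) := rightInverse_invFun hsurj
  have hinv : LipschitzWith μ⁻¹ (invFun (gradient g)) := hanti.to_rightInverse hright
  have hTlip : LocallyLipschitz T := by
    rw [show T = gradient h ∘ invFun (gradient g) from funext hT]
    exact hh.gradient_of_two.locallyLipschitz.comp hinv.locallyLipschitz
  have hFlip : LocallyLipschitz (fun v => T v - v) :=
    ((contDiff_fst (𝕜 := ℝ)).sub contDiff_snd).locallyLipschitz.comp (hTlip.prodMk LocallyLipschitz.id)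
  have hconv := tendstoUniformlyOn_eulerInterp hFlip hy0 hy
  have hgradf : ∀ z, gradient f z = gradient g z - gradient h z := fun z => by
    subst hf
    simp only [gradient]
    rw [fderiv_fun_sub (hgd z) (hhd z), map_sub]
  have hequiv : ∀ z, ∃ e : EuclideanSpace ℝ (Fin n) ≃L[ℝ] EuclideanSpace ℝ (Fin n),
      (e : EuclideanSpace ℝ (Fin n) →L[ℝ] EuclideanSpace ℝ (Fin n)) = fderiv ℝ (gradient g) z :=
    fun z => (fderiv ℝ (gradient g) z).exists_equiv_of_expanding hμ
      ((hGd z).hasFDerivAt.mul_norm_le_of_expanding hexp)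
  choose e he using hequiv
  have hprimal : ∀ t ∈ Icc 0 S, fderiv ℝ (gradient g) (invFun (gradient g) (y t))
      ((e (invFun (gradient g) (y t))).symm (T (y t) - y t)) =
      gradient h (invFun (gradient g) (y t)) - gradient g (invFun (gradient g) (y t)) := by
    intro t _
    rw [← he, ContinuousLinearEquiv.coe_coe, ContinuousLinearEquiv.apply_symm_apply, hT,
      hright (y t)]
  refine ⟨hconv, fun t => invFun (gradient g) (y t),
    fun t => (e (invFun (gradient g) (y t))).symm (T (y t) - y t), ?_, ?_, ?_, ?_⟩
  · simp only [hy0, hleft x₀]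
  · intro t ht
    refine ⟨?_, hprimal t ht, ?_⟩
    · have hd : HasFDerivAt (invFun (gradient g))
          ((e (invFun (gradient g) (y t))).symm :
            EuclideanSpace ℝ (Fin n) →L[ℝ] EuclideanSpace ℝ (Fin n)) (y t) :=
        HasFDerivAt.of_local_left_inverse hinv.continuous.continuousAt
          (by rw [he]; exact (hGd _).hasFDerivAt) (Eventually.of_forall hright)
      exact hd.comp_hasDerivAt t (hy t ht)
    · rw [hprimal t ht, hgradf, neg_sub]
  · intro z z' hz0 hz t ht
    have hw : ∀ t ∈ Icc 0 S, HasDerivAt (fun r => gradient g (z r))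
        (T (gradient g (z t)) - gradient g (z t)) t := fun t ht => by
      have h1 := (hGd (z t)).hasFDerivAt.comp_hasDerivAt t (hz t ht).1
      rwa [(hz t ht).2, ← hleft (z t), ← hT, hleft (z t)] at h1
    have h2 : gradient g (z t) = y t :=
      hFlip.eqOn_of_hasDerivAt hw hy (by simp only [hz0, hy0]) ht
    simp only [← h2, hleft (z t)]
  · exact hinv.uniformContinuous.comp_tendstoUniformlyOn hconv
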